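/- Suppose there exists $t_0\in(0,1]$ such that $\tau$ is non-decreasing on $[0,t_0]$, and let $\widetilde{\tau}:[0,1]\to[0,\infty)$ be a concave, non-decreasing function vanishing only at the origin that is equivalent to $\tau$ (i.e. there exist $m,M>0$ with $m\,\tau\le\widetilde{\tau}\le M\,\tau$ on $[0,1]$). Then $\Lambda_{\widetilde{\tau}}$ embeds continuously into $QA_{\varphi,\psi}$: there exists a constant $C'>0$ such that $\|f\|_{\varphi,\psi}\le C'\,\|f\|_{\Lambda_{\widetilde{\tau}}}$ for every $f\in\Lambda_{\widetilde{\tau}}$. -/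

import Mathlib

open MeasureTheory ENNReal Set Filter Topology

noncomputable section

/-- Lebesgue measure restricted to the interval `[0,1]`. -/
def μ01 : Measure ℝ := volume.restrict (Set.Icc 0 1)

/-- `φ : [0,1] → [0,∞)` is concave, non-decreasing, and vanishes only at the origin. -/
structure IsPhi (φ : ℝ → ℝ) : Prop where
  concave : ConcaveOn ℝ (Set.Icc 0 1) φ
  mono : MonotoneOn φ (Set.Icc 0 1)
  zero : φ 0 = 0
  pos : ∀ t : ℝ, 0 < t → t ≤ 1 → 0 < φ t

/-- `ψ : [0,∞) → [0,∞)` is concave, non-decreasing, and vanishes only at the origin. -/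
structure IsPsi (ψ : ℝ → ℝ) : Prop where
  concave : ConcaveOn ℝ (Set.Ici 0) ψ
  mono : MonotoneOn ψ (Set.Ici 0)
  zero : ψ 0 = 0
  pos : ∀ t : ℝ, 0 < t → 0 < ψ t

/-- A sequence `g` of nonnegative `L^∞` functions with `|f| ≤ ∑ₙ gₙ` a.e. -/
def Admissible (f : ℝ → ℝ) (g : ℕ → ℝ → ℝ) : Prop :=
  (∀ n, AEMeasurable (g n) μ01) ∧
  (∀ n, eLpNorm (g n) ⊤ μ01 < ⊤) ∧
  (∀ n x, 0 ≤ g n x) ∧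
  (∀ᵐ x ∂μ01, ENNReal.ofReal |f x| ≤ ∑' n : ℕ, ENNReal.ofReal (g n x))

/-- The cost `∑ₙ ψ(n) ‖gₙ‖_∞ φ(‖gₙ‖₁/‖gₙ‖_∞)` of a decomposition (index shifted by 1;
`0/0 = 0` by the `ℝ≥0∞` division convention, and `φ 0 = 0`). -/
def seqCost (φ ψ : ℝ → ℝ) (g : ℕ → ℝ → ℝ) : ℝ≥0∞ :=
  ∑' n : ℕ, ENNReal.ofReal
    (ψ ((n : ℝ) + 1) * (eLpNorm (g n) ⊤ μ01).toReal *
      φ ((eLpNorm (g n) 1 μ01 / eLpNorm (g n) ⊤ μ01).toReal))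

/-- The quasi-norm `‖f‖_{φ,ψ}` (equal to `∞` when no admissible decomposition exists). -/
def QANorm (φ ψ : ℝ → ℝ) (f : ℝ → ℝ) : ℝ≥0∞ :=
  ⨅ (g : ℕ → ℝ → ℝ) (_ : Admissible f g), seqCost φ ψ g

/-- Membership in the space `QA_{φ,ψ}`. -/
def MemQA (φ ψ : ℝ → ℝ) (f : ℝ → ℝ) : Prop :=
  AEMeasurable f μ01 ∧ QANorm φ ψ f < ⊤

/-- The decreasing rearrangement `f*` of `f` on `[0,1]`. -/
def decRearr (f : ℝ → ℝ) (t : ℝ) : ℝ :=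
  sInf {s : ℝ | 0 ≤ s ∧ μ01 {x | s < |f x|} ≤ ENNReal.ofReal t}

/-- The limit `ζ(0⁺)` of a non-decreasing function `ζ` on `[0,1]`. -/
def limZero (ζ : ℝ → ℝ) : ℝ := sInf (ζ '' Set.Ioc 0 1)

/-- The Lorentz norm `‖f‖_{Λ_ζ} = ∫₀¹ f* dζ = ‖f‖_∞ ζ(0⁺) + ∫₀¹ f*(s) ζ'(s) ds`
(for `ζ` concave the derivative exists a.e. and `ζ` is absolutely continuous on `(0,1]`). -/
def lorentzNorm (ζ : ℝ → ℝ) (f : ℝ → ℝ) : ℝ≥0∞ :=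
  eLpNorm f ⊤ μ01 * ENNReal.ofReal (limZero ζ) +
    ∫⁻ s in Set.Ioc (0:ℝ) 1, ENNReal.ofReal (decRearr f s * deriv ζ s)

/-- Membership in the Lorentz space `Λ_ζ`. -/
def MemLorentz (ζ : ℝ → ℝ) (f : ℝ → ℝ) : Prop :=
  AEMeasurable f μ01 ∧ lorentzNorm ζ f < ⊤

/-- The quasi-concave function `φ_s(t) = inf_n max{sₙ,t} (φ(sₙ)/sₙ) ψ(n)` (index shifted by 1). -/
def phiSeq (φ ψ : ℝ → ℝ) (s : ℕ → ℝ) (t : ℝ) : ℝ :=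
  if t = 0 then 0 else ⨅ n : ℕ, max (s n) t * (φ (s n) / s n) * ψ ((n : ℝ) + 1)

/-- The function `τ(t) = φ(t) ψ(logbar(φ(t)/t))` with `logbar t = 1 + log⁺ t`. -/
def tauF (φ ψ : ℝ → ℝ) (t : ℝ) : ℝ :=
  if t = 0 then 0 else φ t * ψ (1 + max (Real.log (φ t / t)) 0)

theorem geo_sum (a : ℝ≥0∞) :
    ∑' k : ℤ, (if ENNReal.ofReal ((2:ℝ) ^ k) ≤ a then ENNReal.ofReal ((2:ℝ) ^ k) else 0)
      ≤ 2 * a := by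
  by_cases ha : a = ⊤
  · simp [ha]
  obtain ⟨b, hb0, rfl⟩ : ∃ b : ℝ, 0 ≤ b ∧ a = ENNReal.ofReal b :=
    ⟨a.toReal, ENNReal.toReal_nonneg, (ENNReal.ofReal_toReal ha).symm⟩
  have hdis : Pairwise (Function.onFun Disjoint
      fun k : ℤ => Set.Ioc ((2:ℝ) ^ (k - 1)) ((2:ℝ) ^ k) ∩ Set.Ioc 0 b) := by
    intro i j hij
    refine Set.disjoint_left.2 fun x hx hy => ?_
    rcases lt_or_gt_of_ne hij with hlt | hlt
    · have h1 : (2:ℝ) ^ i ≤ 2 ^ (j - 1) := zpow_le_zpow_right₀ (by norm_num) (by omega)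
      linarith [hx.1.2, hy.1.1]
    · have h1 : (2:ℝ) ^ j ≤ 2 ^ (i - 1) := zpow_le_zpow_right₀ (by norm_num) (by omega)
      linarith [hy.1.2, hx.1.1]
  calc ∑' k : ℤ, (if ENNReal.ofReal ((2:ℝ) ^ k) ≤ ENNReal.ofReal b
          then ENNReal.ofReal ((2:ℝ) ^ k) else 0)
      ≤ ∑' k : ℤ, 2 * volume (Set.Ioc ((2:ℝ) ^ (k - 1)) ((2:ℝ) ^ k) ∩ Set.Ioc 0 b) := by
        refine ENNReal.tsum_le_tsum fun k => ?_
        split_ifs with h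
        · rw [ENNReal.ofReal_le_ofReal_iff hb0] at h
          have hpos : (0:ℝ) < 2 ^ (k - 1) := by positivity
          have : Set.Ioc ((2:ℝ) ^ (k - 1)) ((2:ℝ) ^ k) ∩ Set.Ioc 0 b =
              Set.Ioc ((2:ℝ) ^ (k - 1)) ((2:ℝ) ^ k) := by
            apply Set.inter_eq_left.2
            intro x hx
            exact ⟨hpos.trans hx.1, hx.2.trans h⟩
          rw [this, Real.volume_Ioc]
          have h2 : (2:ℝ) ^ k = 2 * 2 ^ (k - 1) := by
            rw [zpow_sub_one₀ (by norm_num)]; ring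
          have h3 : (2:ℝ≥0∞) = ENNReal.ofReal 2 := by simp
          rw [h3, ← ENNReal.ofReal_mul (by norm_num)]
          apply ENNReal.ofReal_le_ofReal
          linarith
        · exact zero_le
    _ = 2 * ∑' k : ℤ, volume (Set.Ioc ((2:ℝ) ^ (k - 1)) ((2:ℝ) ^ k) ∩ Set.Ioc 0 b) :=
        ENNReal.tsum_mul_left
    _ ≤ 2 * volume (⋃ k : ℤ, Set.Ioc ((2:ℝ) ^ (k - 1)) ((2:ℝ) ^ k) ∩ Set.Ioc 0 b) := by
        gcongr
        exact tsum_meas_le_meas_iUnion_of_disjoint _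
          (fun k => measurableSet_Ioc.inter measurableSet_Ioc) hdis
    _ ≤ 2 * volume (Set.Ioc 0 b) := by
        gcongr
        exact Set.iUnion_subset fun k => Set.inter_subset_right
    _ = 2 * ENNReal.ofReal b := by simp

instance : IsProbabilityMeasure μ01 := ⟨by simp [μ01]⟩

/-- ratio `φ(t)/t` is non-increasing -/
theorem IsPhi.ratio {φ : ℝ → ℝ} (h : IsPhi φ) {s t : ℝ} (hs : 0 < s) (hst : s ≤ t)
    (ht : t ≤ 1) : φ t / t ≤ φ s / s := by
  rcases hst.eq_or_lt with rfl | hlt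
  · exact le_rfl
  have h1 := h.concave.slope_anti_adjacent (x := 0) (y := s) (z := t) (by simp)
    ⟨by linarith, ht⟩ hs hlt
  rw [h.zero, sub_zero, sub_zero, div_le_div_iff₀ (by linarith) hs] at h1
  rw [div_le_div_iff₀ (by linarith) hs]
  nlinarith

theorem IsPhi.le_add {φ : ℝ → ℝ} (h : IsPhi φ) {r u : ℝ} (hr : 0 < r) (hr1 : r ≤ 1)
    (hu : 0 ≤ u) (hu1 : u ≤ 1) : φ u ≤ φ r + φ r / r * u := by
  have hp := h.pos r hr hr1
  have hq : 0 < φ r / r := by positivity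
  rcases le_total u r with hur | hur
  · have := h.mono ⟨hu, hu1⟩ ⟨hr.le, hr1⟩ hur
    nlinarith [mul_nonneg hq.le hu]
  · have h1 := h.ratio hr hur hu1
    have hu0 : 0 < u := by linarith
    rw [div_le_iff₀ hu0] at h1
    linarith

theorem IsPhi.lip {φ : ℝ → ℝ} (h : IsPhi φ) {e : ℝ} (he : 0 < e) (he1 : e ≤ 1) :
    LipschitzOnWith (φ e / e).toNNReal φ (Set.Icc e 1) := by
  have hK : 0 ≤ φ e / e := (div_pos (h.pos e he he1) he).le
  have key : ∀ x ∈ Set.Icc e 1, ∀ y ∈ Set.Icc e 1, x < y →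
      |φ x - φ y| ≤ φ e / e * |x - y| := by
    intro x hx y hy hxy
    have hx0 : 0 < x := lt_of_lt_of_le he hx.1
    have h1 := h.concave.slope_anti_adjacent (x := 0) (y := x) (z := y) (by simp)
      ⟨by linarith, hy.2⟩ hx0 hxy
    rw [h.zero, sub_zero, sub_zero] at h1
    have h2 := h.ratio he hx.1 hx.2
    have h3 := h1.trans h2
    rw [div_le_iff₀ (by linarith)] at h3
    have h4 := h.mono ⟨hx0.le, hx.2⟩ ⟨by linarith, hy.2⟩ hxy.le
    rw [abs_sub_comm, abs_sub_comm x, abs_of_nonneg (by linarith), abs_of_nonneg (by linarith)]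
    exact h3
  apply LipschitzOnWith.of_dist_le_mul
  intro x hx y hy
  rw [Real.coe_toNNReal _ hK, Real.dist_eq, Real.dist_eq]
  rcases lt_trichotomy x y with hxy | rfl | hxy
  · exact key x hx y hy hxy
  · simp
  · rw [abs_sub_comm, abs_sub_comm x]; exact key y hy x hx hxy

theorem IsPhi.deriv_nonneg {φ : ℝ → ℝ} (h : IsPhi φ) {s : ℝ} (hs : s ∈ Set.Ioo (0:ℝ) 1) :
    0 ≤ deriv φ s := by
  rw [← derivWithin_of_mem_nhds (Icc_mem_nhds hs.1 hs.2)]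
  exact h.mono.derivWithin_nonneg

theorem IsPhi.le_lint {φ : ℝ → ℝ} (h : IsPhi φ) {r : ℝ} (hr : 0 < r) (hr1 : r ≤ 1) :
    ENNReal.ofReal (φ r) ≤ ENNReal.ofReal (limZero φ) +
      ∫⁻ s in Set.Ioo 0 r, ENNReal.ofReal (deriv φ s) := by
  have step : ∀ e, 0 < e → e < r → ENNReal.ofReal (φ r) ≤ ENNReal.ofReal (φ e) +
      ∫⁻ s in Set.Ioo 0 r, ENNReal.ofReal (deriv φ s) := by
    intro e he her
    have hac : AbsolutelyContinuousOnInterval φ e r := by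
      apply LipschitzOnWith.absolutelyContinuousOnInterval (K := (φ e / e).toNNReal)
      rw [Set.uIcc_of_le her.le]
      exact (h.lip he (by linarith)).mono (Set.Icc_subset_Icc le_rfl hr1)
    have h1 := hac.integral_deriv_eq_sub
    have h2 := hac.intervalIntegrable_deriv
    rw [intervalIntegral.integral_of_le her.le, integral_Ioc_eq_integral_Ioo] at h1
    have h3 : IntegrableOn (deriv φ) (Set.Ioo e r) :=
      ((intervalIntegrable_iff_integrableOn_Ioc_of_le her.le).1 h2).mono_set
        Set.Ioo_subset_Ioc_self
    have hnn : ∀ᵐ s ∂(volume.restrict (Set.Ioo e r)), 0 ≤ deriv φ s := by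
      refine (ae_restrict_iff' measurableSet_Ioo).2 (Eventually.of_forall fun s hs => ?_)
      exact h.deriv_nonneg ⟨he.trans hs.1, hs.2.trans_le hr1⟩
    have h4 := ofReal_integral_eq_lintegral_ofReal h3 hnn
    have h5 : φ r = φ e + ∫ s in Set.Ioo e r, deriv φ s := by linarith
    rw [h5, ENNReal.ofReal_add (h.pos e he (by linarith)).le (integral_nonneg_of_ae hnn), h4]
    gcongr
  refine ENNReal.le_of_forall_pos_le_add fun δ hδ _ => ?_
  have hne : (φ '' Set.Ioc 0 1).Nonempty := ⟨φ 1, 1, by simp, rfl⟩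
  obtain ⟨_, ⟨e, he, rfl⟩, hlt⟩ := exists_lt_of_csInf_lt hne
    (show sInf (φ '' Set.Ioc 0 1) < limZero φ + δ by
      have : (0:ℝ) < δ := hδ
      unfold limZero; linarith)
  have hl0 : 0 ≤ limZero φ := Real.sInf_nonneg (by
    rintro _ ⟨x, hx, rfl⟩; exact (h.pos x hx.1 hx.2).le)
  have hm : 0 < min e (r / 2) := lt_min he.1 (by linarith)
  have hmr : min e (r / 2) < r := (min_le_right _ _).trans_lt (by linarith)
  have h6 := step _ hm hmr
  have h7 : φ (min e (r / 2)) ≤ limZero φ + δ :=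
    (h.mono ⟨hm.le, by linarith⟩ ⟨he.1.le, he.2⟩ (min_le_left _ _)).trans hlt.le
  calc _ ≤ _ := h6
    _ ≤ ENNReal.ofReal (limZero φ + δ) + _ := by gcongr
    _ = _ := by
      rw [ENNReal.ofReal_add hl0 δ.coe_nonneg, ENNReal.ofReal_coe_nnreal]
      ring

/-- measure of the dyadic superlevel set -/
def rk (f : ℝ → ℝ) (k : ℤ) : ℝ := (μ01 {x | (2:ℝ) ^ k ≤ |f x|}).toReal

theorem rk_nonneg (f : ℝ → ℝ) (k : ℤ) : 0 ≤ rk f k := ENNReal.toReal_nonneg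

theorem rk_le_one (f : ℝ → ℝ) (k : ℤ) : rk f k ≤ 1 := by
  unfold rk
  exact ENNReal.toReal_le_of_le_ofReal zero_le_one (by simpa using prob_le_one)

theorem ofReal_rk (f : ℝ → ℝ) (k : ℤ) :
    ENNReal.ofReal (rk f k) = μ01 {x | (2:ℝ) ^ k ≤ |f x|} :=
  ENNReal.ofReal_toReal (measure_ne_top _ _)

theorem tail_zero {f : ℝ → ℝ} (hf : AEMeasurable f μ01) :
    Tendsto (fun y : ℝ => μ01 {x | y ≤ |f x|}) atTop (𝓝 0) := by
  have hI : (⋂ y : ℝ, {x | y ≤ |f x|}) = ∅ := by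
    ext x
    simp only [Set.mem_iInter, Set.mem_ofPred_eq, Set.mem_empty_iff_false, iff_false, not_forall,
      not_le]
    exact ⟨|f x| + 1, by linarith⟩
  have := tendsto_measure_iInter_atTop (μ := μ01) (s := fun y : ℝ => {x | y ≤ |f x|})
    (fun y => nullMeasurableSet_le aemeasurable_const (by fun_prop))
    (fun a b hab x hx => le_trans hab hx) ⟨0, measure_ne_top _ _⟩
  rw [hI, measure_empty] at this
  exact this

theorem le_decRearr {f : ℝ → ℝ} (hf : AEMeasurable f μ01) {s : ℝ} (hs : 0 < s) {k : ℤ}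
    (hk : s < rk f k) : (2:ℝ) ^ k ≤ decRearr f s := by
  apply le_csInf
  · have h := (tail_zero hf).eventually (gt_mem_nhds (ENNReal.ofReal_pos.2 hs))
    obtain ⟨y, hy, hy0⟩ := (h.and (eventually_ge_atTop 0)).exists
    exact ⟨y, hy0, (measure_mono fun x (hx : y < |f x|) => hx.le).trans hy.le⟩
  · rintro y ⟨hy0, hy⟩
    by_contra! hlt
    have h1 : μ01 {x | (2:ℝ) ^ k ≤ |f x|} ≤ μ01 {x | y < |f x|} :=
      measure_mono fun x hx => hlt.trans_le hx
    rw [← ofReal_rk] at h1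
    have h2 := (ENNReal.ofReal_le_ofReal_iff hs.le).1 (h1.trans hy)
    linarith

theorem lorentz_lower {ζ : ℝ → ℝ} (h : IsPhi ζ) {f : ℝ → ℝ} (hf : AEMeasurable f μ01) :
    ∑' k : ℤ, ENNReal.ofReal ((2:ℝ) ^ k * ζ (rk f k)) ≤ 2 * lorentzNorm ζ f := by
  have hterm : ∀ k : ℤ, ENNReal.ofReal ((2:ℝ) ^ k * ζ (rk f k)) ≤
      (if ENNReal.ofReal ((2:ℝ) ^ k) ≤ eLpNorm f ⊤ μ01 then ENNReal.ofReal ((2:ℝ) ^ k) else 0)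
        * ENNReal.ofReal (limZero ζ) +
      ∫⁻ s in Set.Ioc (0:ℝ) 1, (Set.Ioo 0 (rk f k)).indicator
        (fun s => ENNReal.ofReal ((2:ℝ) ^ k) * ENNReal.ofReal (deriv ζ s)) s := by
    intro k
    rcases (rk_nonneg f k).eq_or_lt with h0 | hpos
    · rw [← h0, h.zero]; simp
    have hle : ENNReal.ofReal ((2:ℝ) ^ k) ≤ eLpNorm f ⊤ μ01 := by
      by_contra! hlt
      rw [eLpNorm_exponent_top] at hlt
      have h1 := ae_lt_of_essSup_lt hlt
      have h2 : μ01 {x | (2:ℝ) ^ k ≤ |f x|} = 0 := by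
        refine measure_mono_null ?_ h1
        intro x hx
        simp only [Set.mem_compl_iff, Set.mem_ofPred_eq, not_lt] at hx ⊢
        rw [Real.enorm_eq_ofReal_abs]
        exact ENNReal.ofReal_le_ofReal hx
      rw [rk, h2] at hpos
      simp at hpos
    rw [if_pos hle, lintegral_indicator measurableSet_Ioo, Measure.restrict_restrict measurableSet_Ioo,
      lintegral_const_mul _ (by fun_prop), ← mul_add, ENNReal.ofReal_mul (by positivity)]
    have hset : Set.Ioo 0 (rk f k) ∩ Set.Ioc 0 1 = Set.Ioo 0 (rk f k) :=
      Set.inter_eq_left.2 fun x hx => ⟨hx.1, hx.2.le.trans (rk_le_one f k)⟩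
    rw [hset]
    gcongr
    exact h.le_lint hpos (rk_le_one f k)
  refine (ENNReal.tsum_le_tsum hterm).trans ?_
  rw [ENNReal.tsum_add, ENNReal.tsum_mul_right, lorentzNorm, mul_add, ← mul_assoc]
  gcongr
  · exact geo_sum _
  · rw [← lintegral_tsum]
    · rw [← lintegral_const_mul' _ _ (by simp)]
      apply lintegral_mono_ae
      have h1 : ∀ᵐ s ∂(volume.restrict (Set.Ioc (0:ℝ) 1)), s ≠ 1 :=
        ae_restrict_of_ae (Measure.ae_ne volume 1)
      filter_upwards [h1, ae_restrict_mem measurableSet_Ioc] with s hs1 hs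
      have hd := h.deriv_nonneg ⟨hs.1, lt_of_le_of_ne hs.2 hs1⟩
      calc _ ≤ ∑' k : ℤ, (if ENNReal.ofReal ((2:ℝ) ^ k) ≤ ENNReal.ofReal (decRearr f s)
              then ENNReal.ofReal ((2:ℝ) ^ k) else 0) * ENNReal.ofReal (deriv ζ s) := by
            refine ENNReal.tsum_le_tsum fun k => ?_
            by_cases hk : s ∈ Set.Ioo 0 (rk f k)
            · rw [Set.indicator_of_mem hk, if_pos]
              exact ENNReal.ofReal_le_ofReal (le_decRearr hf hs.1 hk.2)
            · rw [Set.indicator_of_notMem hk]; exact zero_le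
        _ ≤ 2 * ENNReal.ofReal (decRearr f s) * ENNReal.ofReal (deriv ζ s) := by
            rw [ENNReal.tsum_mul_right]
            gcongr
            exact geo_sum _
        _ = _ := by
            rw [ENNReal.ofReal_mul' hd, mul_assoc]
    · intro k
      exact (Measurable.indicator (by fun_prop) measurableSet_Ioo).aemeasurable

/-- the block number of the dyadic level `k` -/
def blk (φ : ℝ → ℝ) (f : ℝ → ℝ) (k : ℤ) : ℕ :=
  ⌊max (Real.log (φ (rk f k) / rk f k)) 0⌋₊

/-- the dyadic levels in the block `n` -/
def Sn (φ : ℝ → ℝ) (f : ℝ → ℝ) (n : ℕ) : Set ℤ := {k | 0 < rk f k ∧ blk φ f k = n}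

/-- the decomposition of `f` -/
def gn (φ : ℝ → ℝ) (f : ℝ → ℝ) (n : ℕ) (x : ℝ) : ℝ :=
  (⋃ k ∈ Sn φ f n, Set.Ico ((2:ℝ) ^ k) ((2:ℝ) ^ (k + 1))).indicator id |f x|

theorem gn_nonneg (φ f : ℝ → ℝ) (n : ℕ) (x : ℝ) : 0 ≤ gn φ f n x := by
  unfold gn
  exact Set.indicator_apply_nonneg fun _ => abs_nonneg _

theorem gn_measurable (φ : ℝ → ℝ) {f : ℝ → ℝ} (hf : AEMeasurable f μ01) (n : ℕ) :
    AEMeasurable (gn φ f n) μ01 := by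
  have hm : Measurable ((⋃ k ∈ Sn φ f n, Set.Ico ((2:ℝ) ^ k) ((2:ℝ) ^ (k + 1))).indicator
      (id : ℝ → ℝ)) :=
    measurable_id.indicator
      (MeasurableSet.biUnion (Set.to_countable _) fun k _ => measurableSet_Ico)
  exact hm.comp_aemeasurable (by fun_prop : AEMeasurable (fun x => |f x|) μ01)

/-- pointwise description -/
theorem gn_cases (φ f : ℝ → ℝ) (n : ℕ) (x : ℝ) :
    gn φ f n x = 0 ∨ ∃ k ∈ Sn φ f n, (2:ℝ) ^ k ≤ |f x| ∧ gn φ f n x ≤ 2 * (2:ℝ) ^ k := by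
  by_cases h : |f x| ∈ ⋃ k ∈ Sn φ f n, Set.Ico ((2:ℝ) ^ k) ((2:ℝ) ^ (k + 1))
  · right
    have hg : gn φ f n x = |f x| := by unfold gn; rw [Set.indicator_of_mem h]; rfl
    simp only [Set.mem_iUnion] at h
    obtain ⟨k, hk, h1⟩ := h
    refine ⟨k, hk, h1.1, ?_⟩
    rw [hg]
    have h2 := h1.2
    rw [zpow_add_one₀ (by norm_num)] at h2
    linarith
  · left
    unfold gn; rw [Set.indicator_of_notMem h]

theorem Sn_bdd {φ : ℝ → ℝ} (hslope : Tendsto (fun t => φ t / t) (𝓝[>] 0) atTop)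
    {f : ℝ → ℝ} (hf : AEMeasurable f μ01) (n : ℕ) : ∃ B : ℝ, ∀ k ∈ Sn φ f n, (2:ℝ) ^ k ≤ B := by
  have h1 := hslope.eventually (eventually_ge_atTop (Real.exp (n + 1)))
  rw [eventually_nhdsWithin_iff, Metric.eventually_nhds_iff] at h1
  obtain ⟨ε, hε, h1⟩ := h1
  have h2 := (tail_zero hf).eventually (gt_mem_nhds (ENNReal.ofReal_pos.2 hε))
  obtain ⟨B, hB⟩ := eventually_atTop.1 h2
  refine ⟨B, fun k hk => ?_⟩
  by_contra! hlt
  have h3 := hB _ hlt.le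
  rw [← ofReal_rk, ENNReal.ofReal_lt_ofReal_iff hε] at h3
  have h4 := h1 (y := rk f k) (by rw [Real.dist_eq, sub_zero, abs_of_pos hk.1]; exact h3) hk.1
  have h5 : (n:ℝ) + 1 ≤ Real.log (φ (rk f k) / rk f k) := by
    rw [Real.le_log_iff_exp_le ((Real.exp_pos _).trans_le h4)]; exact h4
  have h6 : n + 1 ≤ blk φ f k := by
    apply Nat.le_floor
    push_cast
    exact h5.trans (le_max_left _ _)
  have := hk.2
  omega

theorem gn_admissible {φ : ℝ → ℝ} (hslope : Tendsto (fun t => φ t / t) (𝓝[>] 0) atTop)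
    {f : ℝ → ℝ} (hf : AEMeasurable f μ01) : Admissible f (gn φ f) := by
  refine ⟨gn_measurable φ hf, fun n => ?_, gn_nonneg φ f, ?_⟩
  · obtain ⟨B, hB⟩ := Sn_bdd hslope hf n
    rw [eLpNorm_exponent_top]
    apply eLpNormEssSup_lt_top_of_ae_bound (C := max 0 (2 * B))
    refine Eventually.of_forall fun x => ?_
    rw [Real.norm_of_nonneg (gn_nonneg φ f n x)]
    rcases gn_cases φ f n x with h | ⟨k, hk, -, h⟩
    · rw [h]; exact le_max_left _ _
    · exact (h.trans (by linarith [hB k hk])).trans (le_max_right _ _)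
  · have hae : ∀ᵐ x ∂μ01, ∀ k : ℤ, (2:ℝ) ^ k ≤ |f x| → 0 < rk f k := by
      rw [ae_all_iff]
      intro k
      by_cases h : 0 < rk f k
      · exact Eventually.of_forall fun _ _ => h
      · have h0 : rk f k = 0 := le_antisymm (not_lt.1 h) (rk_nonneg f k)
        have h1 := ofReal_rk f k
        rw [h0, ENNReal.ofReal_zero] at h1
        have h2 : ∀ᵐ x ∂μ01, ¬ ((2:ℝ) ^ k ≤ |f x|) := by
          rw [ae_iff]; simpa using h1.symm
        filter_upwards [h2] with x hx hx2
        exact absurd hx2 hx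
    filter_upwards [hae] with x hx
    by_cases h0 : f x = 0
    · simp [h0]
    obtain ⟨k, hk⟩ := exists_mem_Ico_zpow (abs_pos.2 h0) (one_lt_two : (1:ℝ) < 2)
    have hkS : k ∈ Sn φ f (blk φ f k) := ⟨hx k hk.1, rfl⟩
    have hg : gn φ f (blk φ f k) x = |f x| := by
      unfold gn
      rw [Set.indicator_of_mem]
      · rfl
      · simp only [Set.mem_iUnion]
        exact ⟨k, hkS, hk⟩
    calc ENNReal.ofReal |f x| = ENNReal.ofReal (gn φ f (blk φ f k) x) := by rw [hg]
      _ ≤ _ := ENNReal.le_tsum (f := fun n => ENNReal.ofReal (gn φ f n x)) (blk φ f k)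

open Classical in
theorem gn_L1 (φ : ℝ → ℝ) {f : ℝ → ℝ} (hf : AEMeasurable f μ01) (n : ℕ) :
    eLpNorm (gn φ f n) 1 μ01 ≤
      ∑' k : ℤ, (if k ∈ Sn φ f n then ENNReal.ofReal (2 * (2:ℝ) ^ k * rk f k) else 0) := by
  have hnull : ∀ k : ℤ, NullMeasurableSet {x | (2:ℝ) ^ k ≤ |f x|} μ01 := fun k =>
    nullMeasurableSet_le aemeasurable_const (by fun_prop)
  rw [eLpNorm_one_eq_lintegral_enorm]
  calc ∫⁻ x, ‖gn φ f n x‖ₑ ∂μ01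
      ≤ ∫⁻ x, ∑' k : ℤ, {x | (2:ℝ) ^ k ≤ |f x|}.indicator
        (fun _ => if k ∈ Sn φ f n then ENNReal.ofReal (2 * (2:ℝ) ^ k) else 0) x ∂μ01 := by
        apply lintegral_mono
        intro x
        rcases gn_cases φ f n x with h | ⟨k, hk, h1, h⟩
        · simp [h]
        · refine le_trans ?_ (ENNReal.le_tsum k)
          beta_reduce
          rw [Set.indicator_of_mem (by exact h1), if_pos hk,
            Real.enorm_of_nonneg (gn_nonneg φ f n x)]
          exact ENNReal.ofReal_le_ofReal h
    _ = ∑' k : ℤ, ∫⁻ x, {x | (2:ℝ) ^ k ≤ |f x|}.indicator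
        (fun _ => if k ∈ Sn φ f n then ENNReal.ofReal (2 * (2:ℝ) ^ k) else 0) x ∂μ01 :=
        lintegral_tsum fun k => aemeasurable_const.indicator₀ (hnull k)
    _ ≤ _ := by
        refine ENNReal.tsum_le_tsum fun k => ?_
        rw [lintegral_indicator_const₀ (hnull k), ← ofReal_rk]
        split_ifs with h
        · rw [← ENNReal.ofReal_mul (by positivity)]
        · simp

/-- within a block the slopes `φ(r)/r` are comparable -/
theorem slope_comp {φ : ℝ → ℝ} (hφ : IsPhi φ) {f : ℝ → ℝ} {n : ℕ} {j k : ℤ}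
    (hj : j ∈ Sn φ f n) (hk : k ∈ Sn φ f n) :
    φ (rk f j) / rk f j ≤ Real.exp 1 * (1 + 1 / φ 1) * (φ (rk f k) / rk f k) := by
  have h1p := hφ.pos 1 one_pos le_rfl
  have hqj : 0 < φ (rk f j) / rk f j := div_pos (hφ.pos _ hj.1 (rk_le_one _ _)) hj.1
  have hqk : 0 < φ (rk f k) / rk f k := div_pos (hφ.pos _ hk.1 (rk_le_one _ _)) hk.1
  have hk1 : φ 1 ≤ φ (rk f k) / rk f k := by
    simpa using hφ.ratio hk.1 (rk_le_one f k) le_rfl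
  have hup : φ (rk f j) / rk f j ≤ Real.exp (n + 1) := by
    rw [← Real.log_le_iff_le_exp hqj]
    have h := Nat.lt_floor_add_one (max (Real.log (φ (rk f j) / rk f j)) 0)
    have h2 : ⌊max (Real.log (φ (rk f j) / rk f j)) 0⌋₊ = n := hj.2
    rw [h2] at h
    exact (le_max_left _ _).trans h.le
  have hlow : Real.exp n ≤ (1 + 1 / φ 1) * (φ (rk f k) / rk f k) := by
    rcases Nat.eq_zero_or_pos n with h0 | hn
    · subst h0
      have : 1 ≤ 1 / φ 1 * (φ (rk f k) / rk f k) := by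
        rw [div_mul_eq_mul_div, le_div_iff₀ h1p]; linarith
      simp only [Nat.cast_zero, Real.exp_zero]
      linarith
    · have h := Nat.floor_le (le_max_right (Real.log (φ (rk f k) / rk f k)) 0)
      have h2 : ⌊max (Real.log (φ (rk f k) / rk f k)) 0⌋₊ = n := hk.2
      rw [h2] at h
      have hn' : (0:ℝ) < n := by exact_mod_cast hn
      have h3 : (n:ℝ) ≤ Real.log (φ (rk f k) / rk f k) := by
        rcases le_max_iff.1 h with h | h
        · exact h
        · linarith
      rw [Real.le_log_iff_exp_le hqk] at h3
      have : 0 < 1 / φ 1 * (φ (rk f k) / rk f k) := by positivity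
      linarith
  calc _ ≤ _ := hup
    _ = Real.exp 1 * Real.exp n := by rw [← Real.exp_add]; ring_nf
    _ ≤ Real.exp 1 * ((1 + 1 / φ 1) * (φ (rk f k) / rk f k)) := by gcongr
    _ = _ := by ring

theorem tau_ge {φ ψ : ℝ → ℝ} (hφ : IsPhi φ) (hψ : IsPsi ψ) {f : ℝ → ℝ} {n : ℕ} {k : ℤ}
    (hk : k ∈ Sn φ f n) : ψ ((n:ℝ) + 1) * φ (rk f k) ≤ tauF φ ψ (rk f k) := by
  rw [tauF, if_neg hk.1.ne', mul_comm]
  have h0 := hφ.pos _ hk.1 (rk_le_one f k)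
  have h := Nat.floor_le (le_max_right (Real.log (φ (rk f k) / rk f k)) 0)
  have h2 : ⌊max (Real.log (φ (rk f k) / rk f k)) 0⌋₊ = n := hk.2
  rw [h2] at h
  gcongr
  apply hψ.mono
  · simp only [Set.mem_Ici]; positivity
  · simp only [Set.mem_Ici]; positivity
  · linarith

open Classical in
theorem term_le {φ ψ : ℝ → ℝ} (hφ : IsPhi φ) (hψ : IsPsi ψ)
    (hslope : Tendsto (fun t => φ t / t) (𝓝[>] 0) atTop)
    {f : ℝ → ℝ} (hf : AEMeasurable f μ01) (n : ℕ) :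
    ENNReal.ofReal (ψ ((n : ℝ) + 1) * (eLpNorm (gn φ f n) ⊤ μ01).toReal *
      φ ((eLpNorm (gn φ f n) 1 μ01 / eLpNorm (gn φ f n) ⊤ μ01).toReal)) ≤
    ENNReal.ofReal (4 + 2 * (Real.exp 1 * (1 + 1 / φ 1))) *
      ∑' k : ℤ, (if k ∈ Sn φ f n then ENNReal.ofReal ((2:ℝ) ^ k * tauF φ ψ (rk f k)) else 0) := by
  have h1p := hφ.pos 1 one_pos le_rfl
  have hadm := gn_admissible hslope hf
  set A := Real.exp 1 * (1 + 1 / φ 1) with hA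
  have hA0 : 0 < A := by positivity
  have hLtop := (hadm.2.1 n).ne
  set L := eLpNorm (gn φ f n) ⊤ μ01 with hL
  set N := eLpNorm (gn φ f n) 1 μ01 with hN
  have hNL : N ≤ L := eLpNorm_le_eLpNorm_of_exponent_le le_top
    (gn_measurable φ hf n).aestronglyMeasurable
  have hNtop : N ≠ ⊤ := ne_top_of_le_ne_top hLtop hNL
  by_cases hL0 : L = 0
  · simp [hL0]
  have hl : 0 < L.toReal := ENNReal.toReal_pos hL0 hLtop
  have hψp := hψ.pos ((n:ℝ) + 1) (by positivity)
  obtain ⟨K, hK, hKl⟩ : ∃ K ∈ Sn φ f n, L.toReal ≤ 4 * (2:ℝ) ^ K := by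
    by_contra! hcon
    have h1 : L ≤ ENNReal.ofReal (L.toReal / 2) := by
      rw [hL, eLpNorm_exponent_top, ← eLpNorm_exponent_top, ← hL]
      conv_lhs => rw [hL, eLpNorm_exponent_top]
      apply eLpNormEssSup_le_of_ae_bound
      refine Eventually.of_forall fun x => ?_
      rw [Real.norm_of_nonneg (gn_nonneg φ f n x)]
      rcases gn_cases φ f n x with h | ⟨k, hk, -, h⟩
      · rw [h]; positivity
      · linarith [hcon k hk]
    have h2 := ENNReal.toReal_le_of_le_ofReal (by positivity) h1
    linarith
  have hu : (N / L).toReal = N.toReal / L.toReal := ENNReal.toReal_div _ _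
  have hNL' : N.toReal ≤ L.toReal := ENNReal.toReal_mono hLtop hNL
  have hφu := hφ.le_add hK.1 (rk_le_one f K) (u := N.toReal / L.toReal) (by positivity)
    ((div_le_one hl).2 hNL')
  set q := φ (rk f K) / rk f K with hq
  have hφK := hφ.pos _ hK.1 (rk_le_one f K)
  have hq0 : 0 < q := div_pos hφK hK.1
  set T : ℝ≥0∞ := ∑' k : ℤ,
    (if k ∈ Sn φ f n then ENNReal.ofReal ((2:ℝ) ^ k * tauF φ ψ (rk f k)) else 0) with hT
  have hreal : ψ ((n : ℝ) + 1) * L.toReal * φ ((N / L).toReal) ≤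
      4 * ((2:ℝ) ^ K * tauF φ ψ (rk f K)) + N.toReal * (ψ ((n:ℝ) + 1) * q) := by
    rw [hu]
    have ht := tau_ge hφ hψ hK
    calc _ ≤ ψ ((n : ℝ) + 1) * L.toReal * (φ (rk f K) + q * (N.toReal / L.toReal)) := by gcongr
      _ = L.toReal * (ψ ((n : ℝ) + 1) * φ (rk f K)) + N.toReal * (ψ ((n:ℝ) + 1) * q) := by
          field_simp
      _ ≤ (4 * (2:ℝ) ^ K) * tauF φ ψ (rk f K) + N.toReal * (ψ ((n:ℝ) + 1) * q) := by gcongr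
      _ = _ := by ring
  have hτK : 0 ≤ tauF φ ψ (rk f K) := le_trans (by positivity) (tau_ge hφ hψ hK)
  have hpart1 : ENNReal.ofReal (4 * ((2:ℝ) ^ K * tauF φ ψ (rk f K))) ≤ ENNReal.ofReal 4 * T := by
    rw [ENNReal.ofReal_mul (by norm_num)]
    gcongr
    refine le_trans ?_ (ENNReal.le_tsum K)
    rw [if_pos hK]
  have hpart2 : ENNReal.ofReal (N.toReal * (ψ ((n:ℝ) + 1) * q)) ≤ ENNReal.ofReal (2 * A) * T := by
    rw [ENNReal.ofReal_mul ENNReal.toReal_nonneg, ENNReal.ofReal_toReal hNtop]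
    refine (mul_le_mul_left (gn_L1 φ hf n) _).trans ?_
    rw [← ENNReal.tsum_mul_right, hT, ← ENNReal.tsum_mul_left]
    refine ENNReal.tsum_le_tsum fun k => ?_
    split_ifs with hk
    · have hr := rk_nonneg f k
      rw [← ENNReal.ofReal_mul (by positivity), ← ENNReal.ofReal_mul (by positivity)]
      apply ENNReal.ofReal_le_ofReal
      have hs := slope_comp hφ hK hk
      have ht := tau_ge hφ hψ hk
      have hk0 := hk.1
      calc _ ≤ 2 * (2:ℝ) ^ k * rk f k * (ψ ((n:ℝ) + 1) * (A * (φ (rk f k) / rk f k))) := by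
            gcongr
        _ = 2 * A * ((2:ℝ) ^ k * (ψ ((n:ℝ) + 1) * φ (rk f k))) := by
            field_simp
        _ ≤ _ := by gcongr
    · simp
  calc _ ≤ _ := ENNReal.ofReal_le_ofReal hreal
    _ ≤ _ := ENNReal.ofReal_add_le
    _ ≤ ENNReal.ofReal 4 * T + ENNReal.ofReal (2 * A) * T := add_le_add hpart1 hpart2
    _ = _ := by rw [ENNReal.ofReal_add (by norm_num) (by positivity), add_mul]

theorem seqCost_le {φ ψ : ℝ → ℝ} (hφ : IsPhi φ) (hψ : IsPsi ψ)
    (hslope : Tendsto (fun t => φ t / t) (𝓝[>] 0) atTop) :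
    ∃ A : ℝ, 0 < A ∧ ∀ f : ℝ → ℝ, AEMeasurable f μ01 →
      seqCost φ ψ (gn φ f) ≤
        ENNReal.ofReal A * ∑' k : ℤ, ENNReal.ofReal ((2:ℝ) ^ k * tauF φ ψ (rk f k)) := by
  classical
  have h1p := hφ.pos 1 one_pos le_rfl
  refine ⟨4 + 2 * (Real.exp 1 * (1 + 1 / φ 1)), by positivity, fun f hf => ?_⟩
  refine (ENNReal.tsum_le_tsum fun n => term_le hφ hψ hslope hf n).trans ?_
  rw [ENNReal.tsum_mul_left]
  gcongr
  rw [ENNReal.tsum_comm]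
  refine ENNReal.tsum_le_tsum fun k => ?_
  rw [tsum_eq_single (blk φ f k)]
  · split_ifs
    · exact le_rfl
    · exact zero_le
  · intro n hn
    rw [if_neg]
    exact fun h => hn h.2.symm

/-- if `τ` is non-decreasing on `[0,t₀]` for some `t₀ ∈ (0,1]` and `τ̃` is a
concave, non-decreasing function vanishing only at the origin equivalent to `τ` on `[0,1]`,
then `Λ_{τ̃} ↪ QA_{φ,ψ}` continuously. -/
theorem stmt18 {φ ψ : ℝ → ℝ} (hφ : IsPhi φ) (hψ : IsPsi ψ)
    (hφ0 : Tendsto φ (𝓝[>] 0) (𝓝 0))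
    (hφslope : Tendsto (fun t => φ t / t) (𝓝[>] 0) atTop)
    (c p : ℝ) (hc : 0 < c) (hc1 : c < 1) (hp : 0 < p) (hp1 : p ≤ 1)
    (hreg : MonotoneOn (fun t => φ t / t ^ c) (Set.Ioc 0 p))
    (C : ℝ) (hC : 1 ≤ C) (hψC : ∀ n : ℕ, 1 ≤ n → ψ ((n : ℝ) ^ 2) ≤ C * ψ (n : ℝ))
    (t0 : ℝ) (ht0 : 0 < t0) (ht01 : t0 ≤ 1)
    (hτmono : MonotoneOn (tauF φ ψ) (Set.Icc 0 t0))
    (τ' : ℝ → ℝ) (hτ' : IsPhi τ')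
    (m M : ℝ) (hm : 0 < m) (hM : 0 < M)
    (hequiv : ∀ t ∈ Set.Icc (0:ℝ) 1,
      m * tauF φ ψ t ≤ τ' t ∧ τ' t ≤ M * tauF φ ψ t) :
    ∃ C' : ℝ, 0 < C' ∧ ∀ f : ℝ → ℝ, MemLorentz τ' f →
      QANorm φ ψ f ≤ ENNReal.ofReal C' * lorentzNorm τ' f := by
  have hA := hφ.pos 1 one_pos le_rfl
  obtain ⟨A, hA0, hcost⟩ := seqCost_le hφ hψ hφslope
  refine ⟨A * m⁻¹ * 2, by positivity, fun f hf => ?_⟩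
  have hfm := hf.1
  refine (iInf₂_le (gn φ f) (gn_admissible hφslope hfm)).trans ?_
  refine (hcost f hfm).trans ?_
  have h1 : ∑' k : ℤ, ENNReal.ofReal ((2:ℝ) ^ k * tauF φ ψ (rk f k)) ≤
      ENNReal.ofReal m⁻¹ * ∑' k : ℤ, ENNReal.ofReal ((2:ℝ) ^ k * τ' (rk f k)) := by
    rw [← ENNReal.tsum_mul_left]
    refine ENNReal.tsum_le_tsum fun k => ?_
    rw [← ENNReal.ofReal_mul (by positivity)]
    apply ENNReal.ofReal_le_ofReal
    have h2 := (hequiv (rk f k) ⟨rk_nonneg f k, rk_le_one f k⟩).1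
    have h3 : tauF φ ψ (rk f k) ≤ m⁻¹ * τ' (rk f k) := by
      rw [inv_mul_eq_div, le_div_iff₀ hm]; linarith
    calc _ ≤ (2:ℝ) ^ k * (m⁻¹ * τ' (rk f k)) := by gcongr
      _ = _ := by ring
  calc _ ≤ ENNReal.ofReal A * (ENNReal.ofReal m⁻¹ * (2 * lorentzNorm τ' f)) := by
        gcongr
        exact h1.trans (by gcongr; exact lorentz_lower hτ' hfm)
    _ = _ := by
        rw [ENNReal.ofReal_mul (by positivity), ENNReal.ofReal_mul hA0.le]
        simp only [ENNReal.ofReal_ofNat]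
        ring
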